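/- (Multi-head extension.) Consider a single-layer transformer with H ≥ 1 attention heads, where head h has its own parameters W_Q^h, W_K^h, W_V^h, b_Q^h, b_K^h, b_V^h and projection P_h : ℝ^{d_h} → ℝ^d, and the output is F(t) = Δ(cls(ffn(h_r + Σ_{h=1}^H P_h(s_r^h)))) with s_r^h the attention output of head h at the classification index r. Then for any token τ ∈ V, F is equal on the sequences of k copies of τ for all k ≥ 1, and consequently the non-representability of additive models stated in Proposition 4.1 also holds for multi-head single-layer transformers (encoder or decoder variant): if w_i(τ) ≠ 0 for some τ ∈ V and some i ∈ {2,…,C} with C ≥ 2, no parametrization satisfies F(t) = b + Σ_{i=1}^{n} w_i(t_i) on all sequences of length 1 ≤ n ≤ C. -/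

import Mathlib

open scoped BigOperators

noncomputable section

/-- Dot product on `Fin m → ℝ`. -/
def dotp {m : ℕ} (x y : Fin m → ℝ) : ℝ := ∑ i, x i * y i

/-- One attention head of a multi-head transformer, with its own
query/key/value parameters and output projection `P`. -/
structure Head (d dh : ℕ) where
  WQ : Matrix (Fin d) (Fin dh) ℝ
  WK : Matrix (Fin d) (Fin dh) ℝ
  WV : Matrix (Fin d) (Fin dh) ℝ
  bQ : Fin dh → ℝ
  bK : Fin dh → ℝ
  bV : Fin dh → ℝ
  P : (Fin dh → ℝ) → (Fin d → ℝ)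

namespace Head

variable {d dh : ℕ}

/-- Query vector `(W_Q^h)^⊤ h + b_Q^h`. -/
def qvec (A : Head d dh) (h : Fin d → ℝ) : Fin dh → ℝ :=
  fun j => (∑ i, A.WQ i j * h i) + A.bQ j

/-- Key vector `(W_K^h)^⊤ h + b_K^h`. -/
def kvec (A : Head d dh) (h : Fin d → ℝ) : Fin dh → ℝ :=
  fun j => (∑ i, A.WK i j * h i) + A.bK j

/-- Value vector `(W_V^h)^⊤ h + b_V^h`. -/
def vvec (A : Head d dh) (h : Fin d → ℝ) : Fin dh → ℝ :=
  fun j => (∑ i, A.WV i j * h i) + A.bV j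

end Head

/-- Attention index set `J_i`: full for the encoder (`dec = false`),
causally masked (`j ≤ i`) for the decoder (`dec = true`). -/
def J (dec : Bool) {n : ℕ} (i : Fin n) : Finset (Fin n) :=
  if dec then Finset.univ.filter (fun j => j ≤ i) else Finset.univ

/-- A single-layer transformer with `H` attention heads (no positional embeddings). -/
structure MHTransformer (V : Type*) (d dh H : ℕ) where
  e : V → Fin d → ℝ
  head : Fin H → Head d dh
  ffn : (Fin d → ℝ) → (Fin d → ℝ)
  cls : (Fin d → ℝ) → (Fin 2 → ℝ)

namespace MHTransformer

variable {V : Type*} {d dh H : ℕ}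

/-- Pre-softmax exponentiated attention score of head `a`: `exp(q_i^h ⬝ k_j^h / √dh)`. -/
def score (T : MHTransformer V d dh H) (a : Fin H) {n : ℕ} (t : Fin n → V) (i j : Fin n) : ℝ :=
  Real.exp (dotp ((T.head a).qvec (T.e (t i))) ((T.head a).kvec (T.e (t j))) / Real.sqrt dh)

/-- Attention weight `α_{ij}^h` of head `a`. -/
def attn (T : MHTransformer V d dh H) (a : Fin H) (dec : Bool) {n : ℕ}
    (t : Fin n → V) (i j : Fin n) : ℝ :=
  if j ∈ J dec i then T.score a t i j / ∑ j' ∈ J dec i, T.score a t i j' else 0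

/-- Attention output `s_i^h = Σ_j α_{ij}^h v_j^h` of head `a`. -/
def sout (T : MHTransformer V d dh H) (a : Fin H) (dec : Bool) {n : ℕ}
    (t : Fin n → V) (i : Fin n) : Fin dh → ℝ :=
  ∑ j, T.attn a dec t i j • (T.head a).vvec (T.e (t j))

/-- Classification index: first token for the encoder, last token for the decoder. -/
def clsIdx (dec : Bool) {n : ℕ} (hn : 0 < n) : Fin n :=
  if dec then ⟨n - 1, Nat.sub_lt hn Nat.one_pos⟩ else ⟨0, hn⟩

/-- Log-odds output `F(t) = Δ(cls(ffn(h_r + Σ_h P_h(s_r^h))))`. -/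
def F (T : MHTransformer V d dh H) (dec : Bool) {n : ℕ} (hn : 0 < n) (t : Fin n → V) : ℝ :=
  T.cls (T.ffn (T.e (t (clsIdx dec hn)) +
      ∑ a : Fin H, (T.head a).P (T.sout a dec t (clsIdx dec hn)))) 1
    - T.cls (T.ffn (T.e (t (clsIdx dec hn)) +
      ∑ a : Fin H, (T.head a).P (T.sout a dec t (clsIdx dec hn)))) 0

end MHTransformer

theorem MHTransformer.sout_const {V : Type*} {d dh H : ℕ} (T : MHTransformer V d dh H)
    (a : Fin H) (dec : Bool) {n : ℕ} (τ : V) (i : Fin n) :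
    T.sout a dec (fun _ => τ) i = (T.head a).vvec (T.e τ) := by
  have hi : i ∈ J dec i := by cases dec <;> simp [J]
  have hpos : 0 < ∑ j' ∈ J dec i, T.score a (fun _ => τ) i j' :=
    Finset.sum_pos (fun j _ => Real.exp_pos _) ⟨i, hi⟩
  have h1 : ∑ j, T.attn a dec (fun _ => τ) i j = 1 := by
    unfold MHTransformer.attn
    rw [← Finset.sum_filter, Finset.filter_mem_eq_inter, Finset.univ_inter, ← Finset.sum_div]
    exact div_self hpos.ne'
  unfold MHTransformer.sout
  rw [← Finset.sum_smul, h1, one_smul]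

theorem MHTransformer.F_const {V : Type*} {d dh H : ℕ} (T : MHTransformer V d dh H)
    (dec : Bool) (τ : V) (k : ℕ) (hk : 1 ≤ k) :
    T.F dec hk (fun _ => τ) = T.F dec Nat.one_pos (fun _ : Fin 1 => τ) := by
  simp only [MHTransformer.F, MHTransformer.sout_const]

/-- multi-head extension: for any multi-head single-layer transformer
(encoder or decoder variant) the log-odds output is the same on the sequences of `k`
copies of any token `τ` for every `k ≥ 1`; consequently, no multi-head single-layer
transformer can represent an additive model whose weights are nonzero at some token
and some position `i ∈ {2,…,C}` (i.e. some index `i : Fin C` with `0 < i`). -/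
theorem multihead_const_token_and_cannot_represent_additive {V : Type*} [Fintype V]
    (C : ℕ) (hC : 2 ≤ C) (w : Fin C → V → ℝ) (b : ℝ)
    (hw : ∃ (τ : V) (i : Fin C), 0 < (i : ℕ) ∧ w i τ ≠ 0) :
    (∀ (d dh H : ℕ) (_ : 1 ≤ d) (_ : 1 ≤ dh) (_ : 1 ≤ H)
        (T : MHTransformer V d dh H) (dec : Bool) (τ : V) (k : ℕ) (hk : 1 ≤ k),
        T.F dec hk (fun _ => τ) = T.F dec Nat.one_pos (fun _ : Fin 1 => τ)) ∧
    ¬ ∃ (d dh H : ℕ) (_ : 1 ≤ d) (_ : 1 ≤ dh) (_ : 1 ≤ H)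
        (T : MHTransformer V d dh H) (dec : Bool),
        ∀ (n : ℕ) (hn : 1 ≤ n) (hnC : n ≤ C) (t : Fin n → V),
          T.F dec hn t = b + ∑ i : Fin n, w (Fin.castLE hnC i) (t i) := by
  refine ⟨fun d dh H _ _ _ T dec τ k hk => T.F_const dec τ k hk, ?_⟩
  rintro ⟨d, dh, H, _, _, _, T, dec, h⟩
  obtain ⟨τ, i, hi, hne⟩ := hw
  apply hne
  have e1 := h i.1 hi i.2.le (fun _ => τ)
  have e2 := h (i.1 + 1) (Nat.succ_pos _) i.2 (fun _ => τ)
  rw [T.F_const] at e1 e2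
  rw [Fin.sum_univ_castSucc] at e2
  have e3 : w (Fin.castLE i.2 (Fin.last i.1)) τ = w i τ := rfl
  have e4 : ∑ x : Fin i.1, w (Fin.castLE i.2 x.castSucc) τ
      = ∑ x : Fin i.1, w (Fin.castLE i.2.le x) τ := rfl
  linarith
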